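/- arXiv:2206.06531 — 4 statements merged into one kernel-verified Lean document; each statement's English description precedes it below -/
import Mathlib

section
/- Let E be a real inner product space, f : E → ℝ, R : E → ℝ ∪ {+∞}, x, s, g ∈ E, σ > 0, κ_m > 0 and η₂ ∈ (0,1). Assume (i) R(x) < +∞ and ⟨g,s⟩ + R(x+s) + (σ/2)‖s‖² ≤ R(x); (ii) |f(x+s) − f(x) − ⟨g,s⟩| ≤ κ_m ‖s‖²; (iii) s ≠ 0; and (iv) σ ≥ 2κ_m/(1−η₂). Then Δψ := R(x) − ⟨g,s⟩ − R(x+s) is finite and strictly positive, and with F := f + R the ratio ρ := (F(x) − F(x+s))/Δψ satisfies ρ ≥ η₂ (i.e., the SR2 trial step is accepted). -/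
open scoped RealInnerProductSpace

/-- **SR2 step acceptance (Theorem 1, per-iteration content).**
If the trial step `s` has model value at most that of the zero step, the sampled gradient
is `κm`-accurate, `s ≠ 0` and `σ ≥ 2κm/(1-η₂)`, then the model decrease
`Δψ = R(x) - ⟨g,s⟩ - R(x+s)` is finite and positive and the ratio `ρ ≥ η₂`. -/
theorem sr2_step_accepted {E : Type*} [NormedAddCommGroup E] [InnerProductSpace ℝ E]
    (f : E → ℝ) (R : E → EReal) (x s g : E) (σ κm η₂ : ℝ)
    (hσ : 0 < σ) (hκm : 0 < κm) (hη₂0 : 0 < η₂) (hη₂1 : η₂ < 1)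
    (hRbot : ∀ y, R y ≠ ⊥) (hRx : R x < ⊤)
    (hmodel : ((⟪g, s⟫ : ℝ) : EReal) + R (x + s) + ((σ / 2 * ‖s‖ ^ 2 : ℝ) : EReal) ≤ R x)
    (hacc : |f (x + s) - f x - ⟪g, s⟫| ≤ κm * ‖s‖ ^ 2)
    (hs : s ≠ 0) (hσbig : 2 * κm / (1 - η₂) ≤ σ) :
    R (x + s) < ⊤ ∧
    0 < (R x).toReal - ⟪g, s⟫ - (R (x + s)).toReal ∧
    η₂ ≤ ((f x + (R x).toReal) - (f (x + s) + (R (x + s)).toReal)) /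
          ((R x).toReal - ⟪g, s⟫ - (R (x + s)).toReal) := by
  have hRxs : R (x + s) ≠ ⊤ := by
    intro h
    rw [h, EReal.coe_add_top, EReal.top_add_coe] at hmodel
    exact hmodel.not_gt hRx
  lift R x to ℝ using ⟨hRx.ne, hRbot x⟩ with a
  lift R (x + s) to ℝ using ⟨hRxs, hRbot (x + s)⟩ with b
  have hmodel' : ⟪g, s⟫ + b + σ / 2 * ‖s‖ ^ 2 ≤ a := by exact_mod_cast hmodel
  have hnorm : 0 < ‖s‖ ^ 2 := pow_pos (norm_pos_iff.mpr hs) 2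
  have hdecrease : σ / 2 * ‖s‖ ^ 2 ≤ a - ⟪g, s⟫ - b := by linarith
  have hpos : 0 < a - ⟪g, s⟫ - b := lt_of_lt_of_le (by positivity) hdecrease
  simp only [EReal.toReal_coe]
  refine ⟨EReal.coe_lt_top b, hpos, ?_⟩
  rw [div_le_iff₀ (sub_pos.mpr hη₂1)] at hσbig
  have hκ : κm * ‖s‖ ^ 2 ≤ (1 - η₂) * (a - ⟪g, s⟫ - b) :=
    calc κm * ‖s‖ ^ 2 ≤ (1 - η₂) * (σ / 2) * ‖s‖ ^ 2 := by gcongr; linarith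
      _ = (1 - η₂) * (σ / 2 * ‖s‖ ^ 2) := by ring
      _ ≤ (1 - η₂) * (a - ⟪g, s⟫ - b) :=
        mul_le_mul_of_nonneg_left hdecrease (sub_pos.mpr hη₂1).le
  rw [le_div_iff₀ hpos]
  linarith [(abs_le.mp hacc).2]
end

section
/- Let E be a real inner product space, f : E → ℝ, R : E → ℝ ∪ {+∞}, x, s, g ∈ E, σ > 0 and κ_m > 0. Assume R(x) < +∞, ⟨g,s⟩ + R(x+s) + (σ/2)‖s‖² ≤ R(x), |f(x+s) − f(x) − ⟨g,s⟩| ≤ κ_m ‖s‖², and s ≠ 0. Then, with F := f + R and Δψ := R(x) − ⟨g,s⟩ − R(x+s), the ratio ρ := (F(x) − F(x+s))/Δψ satisfies |ρ − 1| ≤ 2κ_m/σ. -/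
open scoped RealInnerProductSpace

/-- **Key quantitative estimate in Theorem 1 of SR2.**
Under the model-decrease and sampled-gradient-accuracy assumptions, the ratio
`ρ = (F(x) - F(x+s))/Δψ` with `F = f + R` and `Δψ = R(x) - ⟨g,s⟩ - R(x+s)`
satisfies `|ρ - 1| ≤ 2κm/σ`. -/
theorem sr2_ratio_estimate {E : Type*} [NormedAddCommGroup E] [InnerProductSpace ℝ E]
    (f : E → ℝ) (R : E → EReal) (x s g : E) (σ κm : ℝ)
    (hσ : 0 < σ) (hκm : 0 < κm)
    (hRbot : ∀ y, R y ≠ ⊥) (hRx : R x < ⊤)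
    (hmodel : ((⟪g, s⟫ : ℝ) : EReal) + R (x + s) + ((σ / 2 * ‖s‖ ^ 2 : ℝ) : EReal) ≤ R x)
    (hacc : |f (x + s) - f x - ⟪g, s⟫| ≤ κm * ‖s‖ ^ 2)
    (hs : s ≠ 0) :
    |(((f x + (R x).toReal) - (f (x + s) + (R (x + s)).toReal)) /
        ((R x).toReal - ⟪g, s⟫ - (R (x + s)).toReal)) - 1| ≤ 2 * κm / σ := by
  have hxs : R (x + s) ≠ ⊤ := by
    intro htop
    rw [htop, EReal.coe_add_top, EReal.top_add_coe] at hmodel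
    exact hRx.not_ge hmodel
  lift R x to ℝ using ⟨hRx.ne, hRbot x⟩ with a
  lift R (x + s) to ℝ using ⟨hxs, hRbot (x + s)⟩ with b
  simp only [EReal.toReal_coe]
  norm_cast at hmodel
  have hpos : 0 < σ / 2 * ‖s‖ ^ 2 := by positivity
  have hdecrease : 0 < a - ⟪g, s⟫ - b := by linarith
  rw [div_sub_one hdecrease.ne', abs_div, abs_of_pos hdecrease, div_le_iff₀ hdecrease]
  calc |f x + a - (f (x + s) + b) - (a - ⟪g, s⟫ - b)|
      = |f (x + s) - f x - ⟪g, s⟫| := by rw [← abs_neg]; congr 1; ring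
    _ ≤ κm * ‖s‖ ^ 2 := hacc
    _ = 2 * κm / σ * (σ / 2 * ‖s‖ ^ 2) := by field_simp
    _ ≤ 2 * κm / σ * (a - ⟪g, s⟫ - b) := by gcongr; linarith
end

section
/- Let φ_low ∈ ℝ, η₁ > 0, σ_min > 0, ε > 0, σ₀ > 0, γ₁ > 1, γ₃ ∈ (0,1] and σ_max ≥ σ₀. Let (φ_t)_{t=1}^{T+1} be reals with φ_{T+1} ≥ φ_low, and (σ_t)_{t=1}^{T+1} positive reals with σ_{T+1} ≤ σ_max and σ_1 = σ₀. Suppose {1, …, T} is partitioned into disjoint sets S and U such that for t ∈ S: φ_t − φ_{t+1} ≥ (η₁ σ_min/2) ε² and σ_{t+1} ≥ γ₃ σ_t, while for t ∈ U: φ_{t+1} = φ_t and σ_{t+1} ≥ γ₁ σ_t. Then T = |S| + |U| ≤ (2(φ_1 − φ_low)/(η₁ σ_min ε²)) · (1 + log(1/γ₃)/log γ₁) + log(σ_max/σ₀)/log γ₁. In particular T = O(ε⁻²). -/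
/-- If a sequence increases by at least `a` at the indices in `S` and by at least `b` at those in
`U`, where `S` and `U` partition `{1, …, T}`, then its total increase is at least
`|S| a + |U| b`. -/
theorem card_mul_add_card_mul_le_sub {T : ℕ} {S U : Finset ℕ} (hdisj : Disjoint S U)
    (hunion : S ∪ U = Finset.Icc 1 T) {f : ℕ → ℝ} {a b : ℝ}
    (hS : ∀ t ∈ S, a ≤ f (t + 1) - f t) (hU : ∀ t ∈ U, b ≤ f (t + 1) - f t) :
    S.card * a + U.card * b ≤ f (T + 1) - f 1 := by
  have htel : ∑ t ∈ Finset.Icc 1 T, (f (t + 1) - f t) = f (T + 1) - f 1 := by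
    rw [← Finset.Ico_add_one_right_eq_Icc]
    exact Finset.sum_Ico_sub f (by omega)
  rw [← htel, ← hunion, Finset.sum_union hdisj, ← nsmul_eq_mul, ← nsmul_eq_mul]
  exact add_le_add (Finset.card_nsmul_le_sum S _ a hS) (Finset.card_nsmul_le_sum U _ b hU)

/-- **Worst-case iteration complexity of SR2** (`t(ε) = O(ε⁻²)`, combining Lemmas 1 and 2).
With `φ_t` the (expected) objective values, `σ_t` the regularization parameters,
`S` the successful and `U` the unsuccessful iterations among `{1, …, T}`, one has
`T = |S| + |U| ≤ (2(φ₁ - φ_low)/(η₁ σ_min ε²))(1 + log(1/γ₃)/log γ₁) + log(σ_max/σ₀)/log γ₁`. -/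
theorem sr2_iteration_complexity (T : ℕ) (φ σ : ℕ → ℝ)
    (φlow η₁ σmin ε σ0 γ₁ γ₃ σmax : ℝ)
    (hη₁ : 0 < η₁) (hσmin : 0 < σmin) (hε : 0 < ε) (hσ0 : 0 < σ0)
    (hγ₁ : 1 < γ₁) (hγ₃0 : 0 < γ₃) (hγ₃1 : γ₃ ≤ 1) (hσmax : σ0 ≤ σmax)
    (hlow : φlow ≤ φ (T + 1))
    (hσpos : ∀ t, 1 ≤ t → t ≤ T + 1 → 0 < σ t)
    (hσT : σ (T + 1) ≤ σmax) (hσ1 : σ 1 = σ0)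
    (S U : Finset ℕ) (hdisj : Disjoint S U) (hunion : S ∪ U = Finset.Icc 1 T)
    (hSdec : ∀ t ∈ S, η₁ * σmin / 2 * ε ^ 2 ≤ φ t - φ (t + 1))
    (hSσ : ∀ t ∈ S, γ₃ * σ t ≤ σ (t + 1))
    (hUφ : ∀ t ∈ U, φ (t + 1) = φ t)
    (hUσ : ∀ t ∈ U, γ₁ * σ t ≤ σ (t + 1)) :
    T = S.card + U.card ∧
    (T : ℝ) ≤ 2 * (φ 1 - φlow) / (η₁ * σmin * ε ^ 2) *
        (1 + Real.log (1 / γ₃) / Real.log γ₁) +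
      Real.log (σmax / σ0) / Real.log γ₁ := by
  have hcard : T = S.card + U.card := by
    rw [← Finset.card_union_of_disjoint hdisj, hunion, Nat.card_Icc, Nat.add_sub_cancel]
  refine ⟨hcard, ?_⟩
  have hlogγ₁ : 0 < Real.log γ₁ := Real.log_pos hγ₁
  have hlogγ₃ : 0 ≤ Real.log (1 / γ₃) := Real.log_nonneg (one_le_one_div hγ₃0 hγ₃1)
  have hpos : ∀ t ∈ S ∪ U, 0 < σ t ∧ 0 < σ (t + 1) := by
    intro t ht
    rw [hunion, Finset.mem_Icc] at ht
    exact ⟨hσpos t ht.1 (by omega), hσpos (t + 1) (by omega) (by omega)⟩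
  have hlog : ∀ {γ : ℝ} {t : ℕ}, 0 < γ → t ∈ S ∪ U → γ * σ t ≤ σ (t + 1) →
      Real.log γ ≤ Real.log (σ (t + 1)) - Real.log (σ t) := by
    intro γ t hγ ht h
    have hσt := (hpos t ht).1
    rw [le_sub_iff_add_le, ← Real.log_mul hγ.ne' hσt.ne']
    exact Real.log_le_log (mul_pos hγ hσt) h
  have hφ_sum := card_mul_add_card_mul_le_sub hdisj hunion (f := fun t => -φ t)
    (a := η₁ * σmin / 2 * ε ^ 2) (b := 0)
    (fun t ht => by linarith [hSdec t ht]) (fun t ht => by simp [hUφ t ht])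
  have hσ_sum := card_mul_add_card_mul_le_sub hdisj hunion (f := fun t => Real.log (σ t))
    (fun t ht => hlog hγ₃0 (Finset.mem_union_left U ht) (hSσ t ht))
    (fun t ht => hlog (one_pos.trans hγ₁) (Finset.mem_union_right S ht) (hUσ t ht))
  have hS_le : (S.card : ℝ) ≤ 2 * (φ 1 - φlow) / (η₁ * σmin * ε ^ 2) := by
    rw [le_div_iff₀ (by positivity)]
    linarith
  have hU_le : (U.card : ℝ) ≤
      S.card * (Real.log (1 / γ₃) / Real.log γ₁) + Real.log (σmax / σ0) / Real.log γ₁ := by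
    have hσ_log : Real.log (σ (T + 1)) ≤ Real.log σmax :=
      Real.log_le_log (hσpos (T + 1) (by omega) le_rfl) hσT
    rw [← mul_div_assoc, ← add_div, le_div_iff₀ hlogγ₁, one_div, Real.log_inv,
      Real.log_div (hσ0.trans_le hσmax).ne' hσ0.ne']
    simp only [hσ1] at hσ_sum
    linarith
  have hmul := mul_le_mul_of_nonneg_right hS_le (div_nonneg hlogγ₃ hlogγ₁.le)
  have hcard' : (T : ℝ) = S.card + U.card := by exact_mod_cast hcard
  linarith
end

section
/- Let E be a real inner product space, f : E → ℝ differentiable with L-Lipschitz gradient (‖∇f(y) − ∇f(z)‖ ≤ L‖y − z‖ for all y, z), R : E → ℝ ∪ {+∞}, F := f + R, x, g ∈ E, and 0 < σ ≤ σ_max. Suppose s ∈ E minimizes s' ↦ ⟨g,s'⟩ + R(x+s') + (σ/2)‖s'‖² over E and R(x+s) < +∞. Then there exists v ∈ ∂̂F(x+s) with ‖v‖² ≤ 3(L² + σ_max²)‖s‖² + 3‖∇f(x) − g‖²; in particular dist(0, ∂̂F(x+s))² ≤ 3(L² + σ_max²)‖s‖² + 3‖∇f(x) − g‖². -/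
open Filter Topology
open scoped RealInnerProductSpace

/-- The Fréchet subdifferential of `φ : E → ℝ ∪ {+∞}` at `xbar`:
the set of `v` such that
`liminf_{y → xbar, y ≠ xbar} (φ(y) - φ(xbar) - ⟨v, y - xbar⟩)/‖y - xbar‖ ≥ 0`. -/
noncomputable def fsubdiff {E : Type*} [NormedAddCommGroup E] [InnerProductSpace ℝ E]
    (φ : E → EReal) (xbar : E) : Set E :=
  {v | 0 ≤ liminf (fun y : E =>
        (φ y - φ xbar - ((⟪v, y - xbar⟫ : ℝ) : EReal)) * ((‖y - xbar‖⁻¹ : ℝ) : EReal))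
      (𝓝[≠] xbar)}

/-- A vector `v` for which `φ` has an affine minorant with slope `v`, exact at `xbar` up to a
little-o error, is a Fréchet subgradient. -/
theorem mem_fsubdiff_of_isLittleO {E : Type*} [NormedAddCommGroup E] [InnerProductSpace ℝ E]
    {φ : E → EReal} {xbar v : E} {a : ℝ} {r : E → ℝ} (ha : φ xbar = a)
    (hr : r =o[𝓝 xbar] fun y => y - xbar)
    (h : ∀ y, ((a + ⟪v, y - xbar⟫ + r y : ℝ) : EReal) ≤ φ y) :
    v ∈ fsubdiff φ xbar := by
  rcases eq_or_neBot (𝓝[≠] xbar) with hbot | _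
  · simp [fsubdiff, hbot]
  have hlim : Tendsto (fun y => ((r y * ‖y - xbar‖⁻¹ : ℝ) : EReal)) (𝓝[≠] xbar) (𝓝 0) := by
    have := (hr.norm_right.tendsto_div_nhds_zero).mono_left
      (nhdsWithin_le_nhds (s := {xbar}ᶜ))
    simpa only [div_eq_mul_inv, Function.comp_def, EReal.coe_zero] using
      (continuous_coe_real_ereal.tendsto 0).comp this
  refine hlim.liminf_eq.ge.trans (liminf_le_liminf ?_)
  filter_upwards [self_mem_nhdsWithin] with y hy
  have hpos : 0 < ‖y - xbar‖⁻¹ := inv_pos.2 (norm_pos_iff.2 (sub_ne_zero.2 hy))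
  have hy' := h y
  rw [ha]
  generalize φ y = b at hy' ⊢
  induction b with
  | bot => exact absurd (le_bot_iff.1 hy') (EReal.coe_ne_bot _)
  | top =>
    rw [EReal.top_sub_coe, EReal.top_sub_coe, EReal.top_mul_coe_of_pos hpos]
    exact le_top
  | coe b =>
    have hb := EReal.coe_le_coe_iff.1 hy'
    norm_cast
    gcongr
    linarith

/-- Fermat's rule for the quadratically regularized model, combined with a smooth term `f`. -/
theorem gradient_sub_mem_fsubdiff_add {E : Type*} [NormedAddCommGroup E]
    [InnerProductSpace ℝ E] [CompleteSpace E] {f : E → ℝ} {R : E → EReal} {x g s : E} {σ : ℝ}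
    (hf : DifferentiableAt ℝ f (x + s)) (hRbot : ∀ y, R y ≠ ⊥)
    (hmin : ∀ s' : E,
      ((⟪g, s⟫ : ℝ) : EReal) + R (x + s) + ((σ / 2 * ‖s‖ ^ 2 : ℝ) : EReal) ≤
      ((⟪g, s'⟫ : ℝ) : EReal) + R (x + s') + ((σ / 2 * ‖s'‖ ^ 2 : ℝ) : EReal))
    (hfin : R (x + s) < ⊤) :
    gradient f (x + s) - g - σ • s ∈ fsubdiff (fun y => ((f y : ℝ) : EReal) + R y) (x + s) := by
  obtain ⟨ρ, hρ⟩ : ∃ ρ : ℝ, R (x + s) = ρ :=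
    ⟨_, (EReal.coe_toReal hfin.ne (hRbot _)).symm⟩
  have hsq : (fun y => σ / 2 * ‖y - (x + s)‖ ^ 2) =o[𝓝 (x + s)] fun y => y - (x + s) := by
    have h0 : Tendsto (fun y => y - (x + s)) (𝓝 (x + s)) (𝓝 0) :=
      tendsto_sub_nhds_zero_iff.2 tendsto_id
    exact ((Asymptotics.isLittleO_norm_pow_id one_lt_two).comp_tendsto h0).const_mul_left _
  have hfo := (hasGradientAt_iff_isLittleO.1 hf.hasGradientAt).sub hsq
  refine mem_fsubdiff_of_isLittleO (a := f (x + s) + ρ) (by simp [hρ]) hfo fun y => ?_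
  have hy := hmin (y - x)
  rw [hρ, add_sub_cancel] at hy
  have hyb := hRbot y
  generalize R y = b at hy hyb ⊢
  induction b with
  | bot => exact absurd rfl hyb
  | top => simp
  | coe b =>
    norm_cast at hy ⊢
    obtain ⟨d, rfl⟩ : ∃ d, y = x + s + d := ⟨y - (x + s), by abel⟩
    have e : x + s + d - x = s + d := by abel
    rw [e, inner_add_right, norm_add_sq_real] at hy
    simp only [add_sub_cancel_left, inner_sub_left, real_inner_smul_left]
    linarith

theorem norm_sub_sub_sq_le {E : Type*} [SeminormedAddCommGroup E] (a b c : E) :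
    ‖a - b - c‖ ^ 2 ≤ 3 * (‖a‖ ^ 2 + ‖b‖ ^ 2 + ‖c‖ ^ 2) := by
  have h : ‖a - b - c‖ ≤ ‖a‖ + ‖b‖ + ‖c‖ :=
    (norm_sub_le _ _).trans (by gcongr; exact norm_sub_le _ _)
  have := pow_le_pow_left₀ (norm_nonneg _) h 2
  nlinarith [sq_nonneg (‖a‖ - ‖b‖), sq_nonneg (‖a‖ - ‖c‖), sq_nonneg (‖b‖ - ‖c‖)]

/-- **Per-realization stationarity bound in Theorem 4 of SR2.**
If `∇f` is `L`-Lipschitz, `0 < σ ≤ σ_max`, and `s` minimizes the regularized model, then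
some `v ∈ ∂̂F(x+s)` satisfies `‖v‖² ≤ 3(L² + σ_max²)‖s‖² + 3‖∇f(x) - g‖²`; in particular
the same bound holds for `dist(0, ∂̂F(x+s))²`. -/
theorem sr2_stationarity_bound {E : Type*} [NormedAddCommGroup E]
    [InnerProductSpace ℝ E] [CompleteSpace E]
    (f : E → ℝ) (hf : Differentiable ℝ f) (L : ℝ)
    (hLip : ∀ y z, ‖gradient f y - gradient f z‖ ≤ L * ‖y - z‖)
    (R : E → EReal) (hRbot : ∀ y, R y ≠ ⊥)
    (x g s : E) (σ σmax : ℝ) (hσ : 0 < σ) (hσmax : σ ≤ σmax)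
    (hmin : ∀ s' : E,
      ((⟪g, s⟫ : ℝ) : EReal) + R (x + s) + ((σ / 2 * ‖s‖ ^ 2 : ℝ) : EReal) ≤
      ((⟪g, s'⟫ : ℝ) : EReal) + R (x + s') + ((σ / 2 * ‖s'‖ ^ 2 : ℝ) : EReal))
    (hfin : R (x + s) < ⊤) :
    (∃ v ∈ fsubdiff (fun y => ((f y : ℝ) : EReal) + R y) (x + s),
        ‖v‖ ^ 2 ≤ 3 * (L ^ 2 + σmax ^ 2) * ‖s‖ ^ 2 + 3 * ‖gradient f x - g‖ ^ 2) ∧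
    Metric.infDist 0 (fsubdiff (fun y => ((f y : ℝ) : EReal) + R y) (x + s)) ^ 2 ≤
      3 * (L ^ 2 + σmax ^ 2) * ‖s‖ ^ 2 + 3 * ‖gradient f x - g‖ ^ 2 := by
  have hv := gradient_sub_mem_fsubdiff_add (hf (x + s)) hRbot hmin hfin
  have hbound : ‖gradient f (x + s) - g - σ • s‖ ^ 2 ≤
      3 * (L ^ 2 + σmax ^ 2) * ‖s‖ ^ 2 + 3 * ‖gradient f x - g‖ ^ 2 := by
    have hL : ‖gradient f (x + s) - gradient f x‖ ^ 2 ≤ L ^ 2 * ‖s‖ ^ 2 := by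
      have h := hLip (x + s) x
      rw [add_sub_cancel_left] at h
      simpa [mul_pow] using pow_le_pow_left₀ (norm_nonneg _) h 2
    have hs : ‖σ • s‖ ^ 2 ≤ σmax ^ 2 * ‖s‖ ^ 2 := by
      rw [norm_smul, mul_pow, Real.norm_of_nonneg hσ.le]
      gcongr
    have h := norm_sub_sub_sq_le (gradient f (x + s) - gradient f x) (g - gradient f x) (σ • s)
    rw [sub_sub_sub_cancel_right, norm_sub_rev g] at h
    linarith
  refine ⟨⟨_, hv, hbound⟩, le_trans ?_ hbound⟩
  gcongr
  · exact Metric.infDist_nonneg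
  · rw [← dist_zero_left]
    exact Metric.infDist_le_dist_of_mem hv
end
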